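/- In the algebra S, for every 1 ≤ i ≤ N and every r ≥ 0 one has x_i^r y_i^r = Σ_{s=0}^{r} q^{sr − r(r−1)/2} · [r choose s] · z_i^{r−s} z_{i−1}^{s}, where [r choose s] is the balanced quantum binomial coefficient. -/

import Mathlib

open scoped BigOperators

noncomputable section

/-- The base field `F = ℚ(q)`, the field of rational functions in one variable over `ℚ`. -/
abbrev Fq : Type := RatFunc ℚ

/-- The element `q ∈ ℚ(q)`. -/
noncomputable def q : Fq := RatFunc.X

/-- Generators of the free algebra: `Sum.inl i` is `x_i` and `Sum.inr i` is `y_i`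
(indices `0,…,N−1` corresponding to the indices `1,…,N` of the paper). -/
abbrev Gen (N : ℕ) := Fin N ⊕ Fin N

/-- `x_i` in the free algebra. -/
noncomputable def FX (N : ℕ) (i : Fin N) : FreeAlgebra Fq (Gen N) :=
  FreeAlgebra.ι Fq (Sum.inl i)

/-- `y_i` in the free algebra. -/
noncomputable def FY (N : ℕ) (i : Fin N) : FreeAlgebra Fq (Gen N) :=
  FreeAlgebra.ι Fq (Sum.inr i)

/-- Scalars in the free algebra. -/
noncomputable def FC (N : ℕ) (a : Fq) : FreeAlgebra Fq (Gen N) :=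
  algebraMap Fq _ a

/-- The defining relations of the algebra `S`:
`x_i x_j = q x_j x_i` for `i > j`; `y_i y_j = q y_j y_i` for `i < j`;
`y_i x_j = x_j y_i` for `i ≠ j`; and
`y_i x_i = q x_i y_i + (q − q⁻¹) Σ_{r=1}^{i−1} (−q)^r x_{i−r} y_{i−r}`. -/
inductive SRel (N : ℕ) : FreeAlgebra Fq (Gen N) → FreeAlgebra Fq (Gen N) → Prop
  | xx (i j : Fin N) (h : j < i) :
      SRel N (FX N i * FX N j) (FC N q * (FX N j * FX N i))
  | yy (i j : Fin N) (h : i < j) :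
      SRel N (FY N i * FY N j) (FC N q * (FY N j * FY N i))
  | yx (i j : Fin N) (h : i ≠ j) :
      SRel N (FY N i * FX N j) (FX N j * FY N i)
  | yxi (i : Fin N) :
      SRel N (FY N i * FX N i)
        (FC N q * (FX N i * FY N i) +
          FC N (q - q⁻¹) *
            ∑ r ∈ Finset.Icc 1 (i : ℕ),
              FC N ((-q) ^ r) *
                (FX N ⟨(i : ℕ) - r, Nat.lt_of_le_of_lt (Nat.sub_le _ _) i.isLt⟩ *
                 FY N ⟨(i : ℕ) - r, Nat.lt_of_le_of_lt (Nat.sub_le _ _) i.isLt⟩))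

/-- The algebra `S`: quotient of the free algebra by the defining relations. -/
abbrev SAlg (N : ℕ) := RingQuot (SRel N)

/-- `x_i ∈ S`. -/
noncomputable def xel (N : ℕ) (i : Fin N) : SAlg N :=
  RingQuot.mkAlgHom Fq (SRel N) (FX N i)

/-- `y_i ∈ S`. -/
noncomputable def yel (N : ℕ) (i : Fin N) : SAlg N :=
  RingQuot.mkAlgHom Fq (SRel N) (FY N i)

/-- Scalars in `S`. -/
noncomputable def Cq (N : ℕ) (a : Fq) : SAlg N :=
  algebraMap Fq _ a

/-- `z_k = Σ_{r=0}^{k−1} (−q)^r x_{k−r} y_{k−r} ∈ S` (paper indexing `k = 0,1,…,N`,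
with `z_0 = 0`); in the `0`-indexed generators this is
`Σ_{j < k} (−q)^{k−1−j} x_j y_j`. -/
noncomputable def zel (N : ℕ) (k : ℕ) : SAlg N :=
  ∑ j : Fin N,
    if (j : ℕ) < k then Cq N ((-q) ^ (k - 1 - (j : ℕ))) * (xel N j * yel N j) else 0

/-- The balanced quantum integer `[k] = (q^k − q^{−k})/(q − q^{−1})`. -/
noncomputable def qint (k : ℕ) : Fq := (q ^ (k : ℤ) - q ^ (-(k : ℤ))) / (q - q⁻¹)

/-- The balanced quantum factorial `[k]!`. -/
noncomputable def qfact : ℕ → Fq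
  | 0 => 1
  | k + 1 => qint (k + 1) * qfact k

/-- The balanced quantum binomial coefficient `[r choose s]`. -/
noncomputable def qbinom (r s : ℕ) : Fq := qfact r / (qfact s * qfact (r - s))

end

theorem q_ne_zero : q ≠ 0 := RatFunc.X_ne_zero

theorem q_pow_ne_one {n : ℕ} (hn : n ≠ 0) : q ^ n ≠ 1 := by
  intro h
  have h1 : algebraMap (Polynomial ℚ) Fq (Polynomial.X ^ n) =
      algebraMap (Polynomial ℚ) Fq 1 := by
    rw [map_pow, map_one, RatFunc.algebraMap_X]
    exact h
  have h2 := congrArg Polynomial.natDegree (RatFunc.algebraMap_injective ℚ h1)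
  rw [Polynomial.natDegree_X_pow, Polynomial.natDegree_one] at h2
  exact hn h2

theorem qint_succ_ne_zero (k : ℕ) : qint (k + 1) ≠ 0 := by
  have sub_inv_ne_zero (n : ℕ) (hn : n ≠ 0) : q ^ n - (q ^ n)⁻¹ ≠ 0 := by
    intro h
    have hq : q ^ n ≠ 0 := pow_ne_zero _ q_ne_zero
    apply q_pow_ne_one (n := n + n) (by omega)
    rw [pow_add]
    nth_rewrite 2 [sub_eq_zero.mp h]
    exact mul_inv_cancel₀ hq
  rw [qint, zpow_neg, zpow_natCast]
  have h1 := sub_inv_ne_zero 1 one_ne_zero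
  rw [pow_one] at h1
  exact div_ne_zero (sub_inv_ne_zero (k + 1) k.succ_ne_zero) h1

theorem qfact_ne_zero (k : ℕ) : qfact k ≠ 0 := by
  induction k with
  | zero => exact one_ne_zero
  | succ k ih => exact mul_ne_zero (qint_succ_ne_zero k) ih

theorem qint_add (a b : ℕ) :
    qint (a + b) = q ^ (-(a : ℤ)) * qint b + q ^ (b : ℤ) * qint a := by
  have hq := q_ne_zero
  simp only [qint, Nat.cast_add, neg_add, zpow_add₀ hq]
  ring

theorem qbinom_zero_right (r : ℕ) : qbinom r 0 = 1 := by
  simp [qbinom, qfact, qfact_ne_zero]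

theorem qbinom_self (r : ℕ) : qbinom r r = 1 := by
  simp [qbinom, qfact, qfact_ne_zero]

/-- The Pascal identity for balanced quantum binomial coefficients. -/
theorem qbinom_succ_succ {r s : ℕ} (h : s < r) :
    qbinom (r + 1) (s + 1) =
      q ^ (-((s : ℤ) + 1)) * qbinom r (s + 1) + q ^ ((r : ℤ) - s) * qbinom r s := by
  obtain ⟨t, rfl⟩ := Nat.exists_eq_add_of_lt h
  have e1 : s + t + 1 + 1 - (s + 1) = t + 1 := by omega
  have e2 : s + t + 1 - (s + 1) = t := by omega
  have e3 : s + t + 1 - s = t + 1 := by omega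
  have e4 : ((s + t + 1 : ℕ) : ℤ) - s = ((t + 1 : ℕ) : ℤ) := by push_cast; ring
  have e5 : s + t + 1 + 1 = (s + 1) + (t + 1) := by omega
  have h1 : qfact (s + t + 1 + 1) = qint ((s + 1) + (t + 1)) * qfact (s + t + 1) := by
    rw [← e5, qfact]
  have hs := qfact_ne_zero s
  have ht := qfact_ne_zero t
  have hs' := qint_succ_ne_zero s
  have ht' := qint_succ_ne_zero t
  simp only [qbinom, e1, e2, e3, e4]
  rw [h1, qint_add, show qfact (s + 1) = qint (s + 1) * qfact s from rfl,
    show qfact (t + 1) = qint (t + 1) * qfact t from rfl]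
  generalize qfact (s + t + 1) = u
  push_cast
  generalize q ^ (-((s : ℤ) + 1)) = v
  generalize q ^ ((t : ℤ) + 1) = v'
  field_simp

/-- The coefficient of `z ^ (r - s) * w ^ s` in the expansion of `x ^ r * y ^ r`. -/
noncomputable def expansionCoeff (r s : ℕ) : Fq :=
  q ^ (((s * r : ℕ) : ℤ) - ((r * (r - 1) / 2 : ℕ) : ℤ)) * qbinom r s

theorem expansionCoeff_succ_zero (r : ℕ) :
    expansionCoeff (r + 1) 0 = q ^ (-(r : ℤ)) * expansionCoeff r 0 := by
  rw [expansionCoeff, expansionCoeff, Nat.triangle_succ, qbinom_zero_right, qbinom_zero_right,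
    mul_one, mul_one, ← zpow_add₀ q_ne_zero]
  congr 1
  push_cast
  ring

theorem expansionCoeff_succ_self (r : ℕ) :
    expansionCoeff (r + 1) (r + 1) = q ^ ((r : ℤ) + 1) * expansionCoeff r r := by
  rw [expansionCoeff, expansionCoeff, Nat.triangle_succ, qbinom_self, qbinom_self,
    mul_one, mul_one, ← zpow_add₀ q_ne_zero]
  congr 1
  push_cast
  ring

theorem expansionCoeff_succ_succ {r s : ℕ} (h : s < r) :
    expansionCoeff (r + 1) (s + 1) =
      q ^ (-(r : ℤ)) * expansionCoeff r (s + 1) + q ^ ((r : ℤ) + 1) * expansionCoeff r s := by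
  simp only [expansionCoeff, Nat.triangle_succ, qbinom_succ_succ h, mul_add, ← mul_assoc,
    ← zpow_add₀ q_ne_zero]
  congr 3 <;> push_cast <;> ring

section Expansion

variable {A : Type*} [Ring A] [Algebra Fq A]

theorem pow_mul_eq_smul_of_mul_eq_smul {x z : A} {a : Fq} (h : x * z = a • (z * x)) (r : ℕ) :
    x ^ r * z = a ^ r • (z * x ^ r) := by
  induction r with
  | zero => simp
  | succ r ih =>
    rw [pow_succ, mul_assoc, h, mul_smul_comm, ← mul_assoc, ih, smul_mul_assoc, smul_smul,
      mul_assoc, ← pow_succ']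

theorem expansion_succ {z w : A} (hzw : Commute z w) (r : ℕ) :
    (q ^ (-(r : ℤ)) • z + q ^ ((r : ℤ) + 1) • w) *
        ∑ s ∈ Finset.range (r + 1), expansionCoeff r s • (z ^ (r - s) * w ^ s) =
      ∑ s ∈ Finset.range (r + 1 + 1),
        expansionCoeff (r + 1) s • (z ^ (r + 1 - s) * w ^ s) := by
  have hz : z * ∑ s ∈ Finset.range (r + 1), expansionCoeff r s • (z ^ (r - s) * w ^ s) =
      ∑ s ∈ Finset.range r, expansionCoeff r (s + 1) • (z ^ (r - s) * w ^ (s + 1)) +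
        expansionCoeff r 0 • z ^ (r + 1) := by
    rw [Finset.sum_range_succ', mul_add, Finset.mul_sum]
    congr 1
    · refine Finset.sum_congr rfl fun s hs => ?_
      have hs' : r - s = r - (s + 1) + 1 := by have := Finset.mem_range.mp hs; omega
      rw [mul_smul_comm, ← mul_assoc, ← pow_succ', ← hs']
    · rw [mul_smul_comm, ← mul_assoc, Nat.sub_zero, ← pow_succ', pow_zero, mul_one]
  have hw : w * ∑ s ∈ Finset.range (r + 1), expansionCoeff r s • (z ^ (r - s) * w ^ s) =
      ∑ s ∈ Finset.range r, expansionCoeff r s • (z ^ (r - s) * w ^ (s + 1)) +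
        expansionCoeff r r • w ^ (r + 1) := by
    have shift (s : ℕ) : w * (z ^ (r - s) * w ^ s) = z ^ (r - s) * w ^ (s + 1) := by
      rw [← mul_assoc, ← (hzw.pow_left (r - s)).eq, mul_assoc, ← pow_succ']
    rw [Finset.mul_sum, Finset.sum_range_succ]
    simp only [mul_smul_comm, shift]
    rw [Nat.sub_self, pow_zero, one_mul]
  rw [add_mul, smul_mul_assoc, smul_mul_assoc, hz, hw, Finset.sum_range_succ,
    Finset.sum_range_succ', expansionCoeff_succ_self, expansionCoeff_succ_zero]
  have hmid : ∑ s ∈ Finset.range r,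
        expansionCoeff (r + 1) (s + 1) • (z ^ (r + 1 - (s + 1)) * w ^ (s + 1)) =
      q ^ (-(r : ℤ)) •
          ∑ s ∈ Finset.range r, expansionCoeff r (s + 1) • (z ^ (r - s) * w ^ (s + 1)) +
        q ^ ((r : ℤ) + 1) •
          ∑ s ∈ Finset.range r, expansionCoeff r s • (z ^ (r - s) * w ^ (s + 1)) := by
    rw [Finset.smul_sum, Finset.smul_sum, ← Finset.sum_add_distrib]
    refine Finset.sum_congr rfl fun s hs => ?_
    rw [expansionCoeff_succ_succ (Finset.mem_range.mp hs), add_smul, smul_smul, smul_smul,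
      Nat.add_sub_add_right]
  rw [hmid]
  simp only [smul_add, smul_smul, Nat.sub_zero, Nat.sub_self, pow_zero, mul_one, one_mul]
  abel

theorem pow_mul_pow_eq_expansion {x y z w : A} (hxy : x * y = z + q • w)
    (hxz : x * z = q⁻¹ • (z * x)) (hxw : x * w = q • (w * x)) (hzw : Commute z w) (r : ℕ) :
    x ^ r * y ^ r =
      ∑ s ∈ Finset.range (r + 1), expansionCoeff r s • (z ^ (r - s) * w ^ s) := by
  induction r with
  | zero => simp [expansionCoeff, qbinom_self]
  | succ r ih =>
    have step : x ^ (r + 1) * y ^ (r + 1) =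
        (q ^ (-(r : ℤ)) • z + q ^ ((r : ℤ) + 1) • w) * (x ^ r * y ^ r) := by
      rw [pow_succ, pow_succ', mul_assoc, ← mul_assoc x, hxy, ← mul_assoc, mul_add,
        mul_smul_comm, pow_mul_eq_smul_of_mul_eq_smul hxz, pow_mul_eq_smul_of_mul_eq_smul hxw,
        smul_smul, ← mul_assoc (_ + _), add_mul (_ • z), smul_mul_assoc, smul_mul_assoc, zpow_neg,
        zpow_natCast, inv_pow, zpow_add_one₀ q_ne_zero, zpow_natCast, mul_comm q]
    rw [step, ih, expansion_succ hzw]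

theorem mul_eq_inv_smul_of_relations {x y z w : A} (hxy : x * y = z + q • w)
    (hyx : y * x = q • z + w) (hxw : x * w = q • (w * x)) : x * z = q⁻¹ • (z * x) := by
  have h : x * y * x = q • (x * z) + x * w := by
    rw [mul_assoc, hyx, mul_add, mul_smul_comm]
  rw [hxy, add_mul, smul_mul_assoc, ← hxw, add_left_inj] at h
  rw [h, smul_smul, inv_mul_cancel₀ q_ne_zero, one_smul]

theorem commute_of_relations {x y z w : A} (hxy : x * y = z + q • w)
    (hxw : x * w = q • (w * x)) (hyw : y * w = q⁻¹ • (w * y)) : Commute z w := by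
  have hz : z = x * y - q • w := by rw [hxy, add_sub_cancel_right]
  have h : Commute (x * y) w := by
    rw [Commute, SemiconjBy, mul_assoc, hyw, mul_smul_comm, ← mul_assoc, hxw, smul_mul_assoc,
      smul_smul, inv_mul_cancel₀ q_ne_zero, one_smul, mul_assoc]
  rw [hz]
  exact h.sub_left ((Commute.refl w).smul_left q)

end Expansion

section Relations

variable {N : ℕ}

theorem xel_mul_xel {i j : Fin N} (h : j < i) :
    xel N i * xel N j = q • (xel N j * xel N i) := by
  have := RingQuot.mkAlgHom_rel Fq (SRel.xx i j h)
  simp only [FC, ← Algebra.smul_def, map_smul, map_mul] at this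
  exact this

theorem yel_mul_yel {i j : Fin N} (h : i < j) :
    yel N i * yel N j = q • (yel N j * yel N i) := by
  have := RingQuot.mkAlgHom_rel Fq (SRel.yy i j h)
  simp only [FC, ← Algebra.smul_def, map_smul, map_mul] at this
  exact this

theorem yel_mul_xel {i j : Fin N} (h : i ≠ j) : yel N i * xel N j = xel N j * yel N i := by
  have := RingQuot.mkAlgHom_rel Fq (SRel.yx i j h)
  simp only [map_mul] at this
  exact this

theorem zel_eq_sum (k : ℕ) :
    zel N k = ∑ j ∈ Finset.univ.filter (fun j : Fin N => (j : ℕ) < k),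
      (-q) ^ (k - 1 - (j : ℕ)) • (xel N j * yel N j) := by
  simp only [zel, Cq, ← Algebra.smul_def, Finset.sum_filter]

theorem zel_succ (i : Fin N) :
    zel N ((i : ℕ) + 1) = xel N i * yel N i - q • zel N i := by
  have hfilter : (Finset.univ.filter fun j : Fin N => (j : ℕ) < (i : ℕ) + 1) =
      insert i (Finset.univ.filter fun j : Fin N => (j : ℕ) < (i : ℕ)) := by
    ext j
    simp only [Finset.mem_filter, Finset.mem_univ, true_and, Finset.mem_insert, Fin.ext_iff]
    omega
  rw [zel_eq_sum, zel_eq_sum, hfilter, Finset.sum_insert (by simp), Finset.smul_sum,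
    sub_eq_add_neg, ← Finset.sum_neg_distrib]
  congr 1
  · simp
  · refine Finset.sum_congr rfl fun j hj => ?_
    have hj' : (i : ℕ) + 1 - 1 - j = i - 1 - j + 1 := by
      have := (Finset.mem_filter.mp hj).2
      omega
    rw [hj', pow_succ', smul_smul, ← neg_smul, neg_mul]

theorem xel_mul_yel (i : Fin N) :
    xel N i * yel N i = zel N ((i : ℕ) + 1) + q • zel N i := by
  rw [zel_succ, sub_add_cancel]

theorem sum_Icc_eq_zel (i : Fin N) :
    ∑ r ∈ Finset.Icc 1 (i : ℕ), (-q) ^ r •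
        (xel N ⟨(i : ℕ) - r, Nat.lt_of_le_of_lt (Nat.sub_le _ _) i.isLt⟩ *
          yel N ⟨(i : ℕ) - r, Nat.lt_of_le_of_lt (Nat.sub_le _ _) i.isLt⟩) =
      (-q) • zel N i := by
  rw [zel_eq_sum, Finset.smul_sum]
  refine Finset.sum_bij
    (fun r _ => ⟨(i : ℕ) - r, Nat.lt_of_le_of_lt (Nat.sub_le _ _) i.isLt⟩) ?_ ?_ ?_ ?_
  · intro r hr
    simp only [Finset.mem_Icc] at hr
    simp only [Finset.mem_filter, Finset.mem_univ, true_and]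
    omega
  · intro r hr t ht h
    simp only [Finset.mem_Icc] at hr ht
    simp only [Fin.mk.injEq] at h
    omega
  · intro j hj
    simp only [Finset.mem_filter, Finset.mem_univ, true_and] at hj
    refine ⟨i - j, ?_, ?_⟩
    · simp only [Finset.mem_Icc]
      omega
    · ext
      simp only
      omega
  · intro r hr
    simp only [Finset.mem_Icc] at hr
    have hr' : (i : ℕ) - 1 - (i - r) + 1 = r := by omega
    simp only [smul_smul]
    rw [← pow_succ', hr']

theorem yel_mul_xel_self (i : Fin N) :
    yel N i * xel N i = q • zel N ((i : ℕ) + 1) + zel N i := by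
  have h := RingQuot.mkAlgHom_rel Fq (SRel.yxi i)
  simp only [FC, ← Algebra.smul_def, map_add, map_smul, map_sum, map_mul] at h
  have h' : yel N i * xel N i = q • (xel N i * yel N i) + (q - q⁻¹) • ((-q) • zel N i) := by
    rw [← sum_Icc_eq_zel]
    exact h
  have hq : q * q + (q - q⁻¹) * -q = 1 := by
    have := q_ne_zero
    field_simp
    ring
  rw [h', xel_mul_yel, smul_add, smul_smul, smul_smul, add_assoc, ← add_smul, hq, one_smul]

theorem xel_mul_zel (i : Fin N) : xel N i * zel N i = q • (zel N i * xel N i) := by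
  rw [zel_eq_sum, Finset.mul_sum, Finset.sum_mul, Finset.smul_sum]
  refine Finset.sum_congr rfl fun j hj => ?_
  have hj : j < i := (Finset.mem_filter.mp hj).2
  rw [mul_smul_comm, smul_mul_assoc, smul_comm q, ← mul_assoc, xel_mul_xel hj, smul_mul_assoc,
    mul_assoc, mul_assoc, yel_mul_xel hj.ne]

theorem yel_mul_zel (i : Fin N) : yel N i * zel N i = q⁻¹ • (zel N i * yel N i) := by
  rw [zel_eq_sum, Finset.mul_sum, Finset.sum_mul, Finset.smul_sum]
  refine Finset.sum_congr rfl fun j hj => ?_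
  have hj : j < i := (Finset.mem_filter.mp hj).2
  rw [mul_smul_comm, smul_mul_assoc, smul_comm q⁻¹, ← mul_assoc, yel_mul_xel hj.ne', mul_assoc,
    mul_assoc, yel_mul_yel hj, mul_smul_comm, inv_smul_smul₀ q_ne_zero]

end Relations

theorem stmt12 (N : ℕ) (hN : 2 ≤ N) (i : Fin N) (r : ℕ) :
    xel N i ^ r * yel N i ^ r =
      ∑ s ∈ Finset.range (r + 1),
        Cq N (q ^ (((s * r : ℕ) : ℤ) - ((r * (r - 1) / 2 : ℕ) : ℤ)) * qbinom r s) *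
          (zel N ((i : ℕ) + 1) ^ (r - s) * zel N (i : ℕ) ^ s) := by
  simp only [Cq, ← Algebra.smul_def]
  have hxy := xel_mul_yel i
  have hxw := xel_mul_zel i
  exact pow_mul_pow_eq_expansion hxy
    (mul_eq_inv_smul_of_relations hxy (yel_mul_xel_self i) hxw) hxw
    (commute_of_relations hxy hxw (yel_mul_zel i)) r
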